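/- arXiv:1906.09713 — 3 statements merged into one kernel-verified Lean document; each statement's English description precedes it below -/
import Mathlib

section
/- Bidding the zero-crossing z⁰ is a dominant strategy in the first round of the two-bid penalty-bidding mechanism, and it guarantees voluntary participation: for every threshold t ∈ ℝ (the (m+1)-th highest bid, determined by the other agents' reports) and every alternative bid b ∈ ℝ, defining payoff(b) = Û(t) if b > t and payoff(b) = 0 if b ≤ t (an agent is allocated exactly when her bid strictly exceeds the threshold, and an allocated agent who then chooses her penalty optimally among penalties at least t obtains subjective expected utility Û(t)), one has payoff(z⁰) ≥ payoff(b) and payoff(z⁰) ≥ 0. -/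
open MeasureTheory Real Set Filter
open scoped ENNReal

/-- The subjective expected utility of an agent with immediate value `V`, future value `w`,
subjective present-bias factor `βh`, facing no-show penalty `z`:
`û(z) = E[(V + w)·1{V ≥ -z - β̂·w}] - z·P(V < -z - β̂·w)`. -/
noncomputable def uhat {Ω : Type*} [MeasurableSpace Ω] (P : Measure Ω)
    (V : Ω → ℝ) (w βh : ℝ) (z : ℝ) : ℝ :=
  (∫ ω in {ω | V ω ≥ -z - βh * w}, (V ω + w) ∂P)
    - z * (P {ω | V ω < -z - βh * w}).toReal

/-- The random variable `V + w` is integrable on the event that `V` exceeds a given level, as soon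
as its positive part is integrable. -/
lemma integrableOn_add_const_of_ge {Ω : Type*} [MeasurableSpace Ω] (P : Measure Ω)
    [IsFiniteMeasure P] {V : Ω → ℝ} (hV : Measurable V) (w a : ℝ)
    (hint : Integrable (fun ω => max (V ω + w) 0) P) :
    IntegrableOn (fun ω => V ω + w) {ω | V ω ≥ a} P := by
  have hbound : Integrable (fun ω => max (V ω + w) 0 + |a + w|) P :=
    hint.add (integrable_const _)
  refine hbound.integrableOn.mono' (hV.add_const w).aestronglyMeasurable ?_
  refine (ae_restrict_iff' (measurableSet_le measurable_const hV)).mpr (ae_of_all _ ?_)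
  intro ω hω
  have hω' : a ≤ V ω := hω
  rw [Real.norm_eq_abs, abs_le]
  constructor
  · linarith [neg_abs_le (a + w), le_max_right (V ω + w) 0]
  · linarith [abs_nonneg (a + w), le_max_left (V ω + w) 0]

/-- The subjective expected utility is bounded above over the penalties `z ≥ t`. -/
lemma bddAbove_uhat_image_Ici {Ω : Type*} [MeasurableSpace Ω] (P : Measure Ω)
    [IsProbabilityMeasure P] {V : Ω → ℝ} (hV : Measurable V) (w βh : ℝ)
    (hint : Integrable (fun ω => max (V ω + w) 0) P) (t : ℝ) :
    BddAbove (uhat P V w βh '' Set.Ici t) := by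
  refine ⟨∫ ω, max (V ω + w) 0 ∂P + |t|, ?_⟩
  rintro _ ⟨z, hz, rfl⟩
  have hgain : ∫ ω in {ω | V ω ≥ -z - βh * w}, (V ω + w) ∂P ≤ ∫ ω, max (V ω + w) 0 ∂P :=
    (setIntegral_mono (integrableOn_add_const_of_ge P hV w _ hint) hint.integrableOn
      fun ω => le_max_left _ _).trans
      (setIntegral_le_integral hint (ae_of_all _ fun ω => le_max_right _ _))
  have hz' : -|t| ≤ z := (neg_abs_le t).trans hz
  have hp0 : 0 ≤ (P {ω | V ω < -z - βh * w}).toReal := ENNReal.toReal_nonneg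
  have hp1 : (P {ω | V ω < -z - βh * w}).toReal ≤ 1 := measureReal_le_one
  have hcost : -|t| ≤ z * (P {ω | V ω < -z - βh * w}).toReal := by
    nlinarith [abs_nonneg t, mul_le_mul_of_nonneg_right hz' hp0,
      mul_le_mul_of_nonneg_left hp1 (abs_nonneg t)]
  unfold uhat
  linarith

/-- Bidding the zero-crossing `z⁰` is a dominant strategy in the first round of the
two-bid penalty-bidding mechanism and guarantees voluntary participation: for every
threshold `t` (the `(m+1)`-th highest bid) and alternative bid `b`, with
`payoff(b) = Û(t)` if `b > t` and `0` otherwise, we have `payoff(z⁰) ≥ payoff(b)` and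
`payoff(z⁰) ≥ 0`. -/
theorem zero_crossing_bid_dominant {Ω : Type*} [MeasurableSpace Ω] (P : Measure Ω)
    [IsProbabilityMeasure P] (V : Ω → ℝ) (hV : Measurable V)
    (w : ℝ) (hw : 0 ≤ w) (βh : ℝ) (hβh : βh ∈ Set.Icc (0 : ℝ) 1)
    (hA2 : Integrable (fun ω => max (V ω + w) 0) P)
    (hA3 : (((∫ ω, max (V ω) 0 ∂P : ℝ) : EReal)
        - ((∫⁻ ω, ENNReal.ofReal (-(V ω)) ∂P : ℝ≥0∞) : EReal)) + (w : ℝ) < 0)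
    (z0 : ℝ) (hz0 : sSup (uhat P V w βh '' Set.Ici z0) = 0)
    (hz0' : ∀ z > z0, sSup (uhat P V w βh '' Set.Ici z) < 0)
    (t b : ℝ) :
    (if z0 > t then sSup (uhat P V w βh '' Set.Ici t) else 0)
        ≥ (if b > t then sSup (uhat P V w βh '' Set.Ici t) else 0)
      ∧ (if z0 > t then sSup (uhat P V w βh '' Set.Ici t) else 0) ≥ 0 := by
  have payoff_nonneg : t < z0 → 0 ≤ sSup (uhat P V w βh '' Set.Ici t) := by
    intro ht
    rw [← hz0]
    exact csSup_le_csSup (bddAbove_uhat_image_Ici P hV w βh hA2 t) (nonempty_Ici.image _)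
      (image_mono (Ici_subset_Ici.mpr ht.le))
  have payoff_nonpos : z0 ≤ t → sSup (uhat P V w βh '' Set.Ici t) ≤ 0 := by
    intro ht
    rcases ht.eq_or_lt with rfl | ht
    · exact hz0.le
    · exact (hz0' t ht).le
  rcases lt_or_ge t z0 with ht | ht
  · have h := payoff_nonneg ht
    rw [if_pos ht]
    refine ⟨?_, h⟩
    split_ifs
    · exact le_rfl
    · exact h
  · have h := payoff_nonpos ht
    rw [if_neg ht.not_gt]
    refine ⟨?_, le_rfl⟩
    split_ifs
    · exact h
    · exact le_rfl
end

section
/- For every minimum penalty z̲ ≤ z⁰, the supremum defining Û(z̲) is attained: there exists z* ≥ z̲ with û(z*) = Û(z̲). (Hence an allocated agent's optimal second-round bid, her preferred penalty among those weakly above the (m+1)-th highest bid, exists.) -/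
open MeasureTheory Real Set Filter
open scoped ENNReal

/-- A monotone right-continuous function on `ℝ` is upper semicontinuous. -/
lemma upperSemicontinuous_of_monotone_of_continuousWithinAt_Ici {f : ℝ → ℝ} (hf : Monotone f)
    (hc : ∀ x, ContinuousWithinAt f (Ici x) x) : UpperSemicontinuous f := by
  intro x y hy
  have h : ∀ᶠ u in nhdsWithin x (Ioi x), f u < y :=
    ((hc x).mono Ioi_subset_Ici_self).eventually (gt_mem_nhds hy)
  obtain ⟨u, hu, hxu⟩ := (h.and self_mem_nhdsWithin).exists
  filter_upwards [Iio_mem_nhds hxu] with v hv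
  exact (hf hv.le).trans_lt hu

section

variable {Ω : Type*} [MeasurableSpace Ω] {P : Measure Ω} [IsProbabilityMeasure P] {V : Ω → ℝ}
  {w βh : ℝ}

lemma integrable_max_add_mul (hV : Measurable V) (hw : 0 ≤ w) (hβ : βh ≤ 1)
    (hA2 : Integrable (fun ω => max (V ω + w) 0) P) (c : ℝ) :
    Integrable (fun ω => max (V ω + βh * w) c) P := by
  refine (hA2.add (integrable_const |c|)).mono' (by fun_prop) (ae_of_all _ fun ω => ?_)
  have h1 : βh * w ≤ w := mul_le_of_le_one_left hw hβ
  have h2 := neg_abs_le c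
  have h3 := le_abs_self c
  have h4 := le_max_left (V ω + w) 0
  have h5 := le_max_right (V ω + w) 0
  simp only [Pi.add_apply, Real.norm_eq_abs]
  rw [abs_le]
  exact ⟨by linarith [le_max_right (V ω + βh * w) c], max_le (by linarith) (by linarith)⟩

/-- The utility splits into a Lipschitz part and a nonnegative multiple of a distribution
function. -/
lemma uhat_eq_integral_max_add_cdf (hV : Measurable V) (hw : 0 ≤ w) (hβ : βh ≤ 1)
    (hA2 : Integrable (fun ω => max (V ω + w) 0) P) (z : ℝ) :
    uhat P V w βh z = (∫ ω, max (V ω + βh * w) (-z) ∂P)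
      + (1 - βh) * w * ProbabilityTheory.cdf (P.map (fun ω => -V ω)) (z + βh * w) := by
  have hS : MeasurableSet {ω | V ω ≥ -z - βh * w} := measurableSet_le measurable_const hV
  have hcompl : {ω | V ω ≥ -z - βh * w}ᶜ = {ω | V ω < -z - βh * w} := by
    ext ω
    simp only [mem_compl_iff, mem_ofPred_eq, ge_iff_le, not_le]
  have hmax := integrable_max_add_mul hV hw hβ hA2 (-z)
  have hneg : Measurable (fun ω => -V ω) := hV.neg
  have : IsProbabilityMeasure (P.map (fun ω => -V ω)) :=
    Measure.isProbabilityMeasure_map hneg.aemeasurable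
  have hcdf : ProbabilityTheory.cdf (P.map (fun ω => -V ω)) (z + βh * w)
      = P.real {ω | V ω ≥ -z - βh * w} := by
    rw [ProbabilityTheory.cdf_eq_real, map_measureReal_apply hneg measurableSet_Iic]
    congr 1
    ext ω
    simp only [mem_preimage, mem_Iic, mem_ofPred_eq, ge_iff_le]
    constructor <;> intro h <;> linarith
  have h1 : ∫ ω in {ω | V ω ≥ -z - βh * w}, (V ω + w) ∂P
      = (∫ ω in {ω | V ω ≥ -z - βh * w}, max (V ω + βh * w) (-z) ∂P)
        + P.real {ω | V ω ≥ -z - βh * w} • ((1 - βh) * w) := by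
    rw [← setIntegral_const, ← integral_add hmax.integrableOn
      (integrable_const _)]
    refine setIntegral_congr_fun hS fun ω hω => ?_
    simp only [mem_ofPred_eq, ge_iff_le] at hω
    rw [max_eq_left (by linarith)]
    ring
  have h2 : ∫ ω in {ω | V ω ≥ -z - βh * w}ᶜ, max (V ω + βh * w) (-z) ∂P
      = P.real {ω | V ω < -z - βh * w} • (-z) := by
    rw [← setIntegral_const, ← hcompl]
    refine setIntegral_congr_fun hS.compl fun ω hω => ?_
    simp only [mem_compl_iff, mem_ofPred_eq, ge_iff_le, not_le] at hω
    exact max_eq_right (by linarith)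
  rw [uhat, hcdf, h1, ← integral_add_compl hS hmax, h2, smul_eq_mul, smul_eq_mul, measureReal_def,
    measureReal_def]
  ring

lemma continuous_integral_max_neg {f : Ω → ℝ} (hf : ∀ c, Integrable (fun ω => max (f ω) c) P) :
    Continuous fun z : ℝ => ∫ ω, max (f ω) (-z) ∂P := by
  refine LipschitzWith.continuous (K := 1) (LipschitzWith.of_dist_le_mul fun x y => ?_)
  rw [dist_eq_norm, ← integral_sub (hf _) (hf _), NNReal.coe_one, one_mul]
  refine (norm_integral_le_of_norm_le_const (C := dist x y) (ae_of_all _ fun ω => ?_)).trans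
    (by simp)
  rw [Real.norm_eq_abs, Real.dist_eq]
  refine (abs_max_sub_max_le_max _ _ _ _).trans ?_
  rw [sub_self, abs_zero, neg_sub_neg, abs_sub_comm y x]
  exact max_le (abs_nonneg _) le_rfl

lemma upperSemicontinuous_uhat (hV : Measurable V) (hw : 0 ≤ w) (hβ : βh ≤ 1)
    (hA2 : Integrable (fun ω => max (V ω + w) 0) P) :
    UpperSemicontinuous (uhat P V w βh) := by
  rw [funext (uhat_eq_integral_max_add_cdf hV hw hβ hA2)]
  have hc : 0 ≤ (1 - βh) * w := mul_nonneg (by linarith) hw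
  refine (continuous_integral_max_neg (integrable_max_add_mul hV hw hβ hA2)
    ).upperSemicontinuous.add
    (upperSemicontinuous_of_monotone_of_continuousWithinAt_Ici ?_ fun x => ?_)
  · intro x y hxy
    exact mul_le_mul_of_nonneg_left (ProbabilityTheory.monotone_cdf _ (by linarith)) hc
  · refine continuousWithinAt_const.mul (ContinuousWithinAt.comp (t := Ici (x + βh * w))
      ((ProbabilityTheory.cdf _).right_continuous _) (by fun_prop) fun y hy => ?_)
    simpa using hy

end

/-- For every minimum penalty `z̲ ≤ z⁰`, the supremum defining `Û(z̲)` is attained: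
there exists `z* ≥ z̲` with `û(z*) = Û(z̲)`. -/
theorem Uhat_sup_attained {Ω : Type*} [MeasurableSpace Ω] (P : Measure Ω)
    [IsProbabilityMeasure P] (V : Ω → ℝ) (hV : Measurable V)
    (w : ℝ) (hw : 0 ≤ w) (βh : ℝ) (hβh : βh ∈ Set.Icc (0 : ℝ) 1)
    (hA2 : Integrable (fun ω => max (V ω + w) 0) P)
    (hA3 : (((∫ ω, max (V ω) 0 ∂P : ℝ) : EReal)
        - ((∫⁻ ω, ENNReal.ofReal (-(V ω)) ∂P : ℝ≥0∞) : EReal)) + (w : ℝ) < 0)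
    (z0 : ℝ) (hz0 : sSup (uhat P V w βh '' Set.Ici z0) = 0)
    (hz0' : ∀ z > z0, sSup (uhat P V w βh '' Set.Ici z) < 0)
    (zmin : ℝ) (hzmin : zmin ≤ z0) :
    ∃ zstar : ℝ, zmin ≤ zstar
      ∧ uhat P V w βh zstar = sSup (uhat P V w βh '' Set.Ici zmin) := by
  obtain ⟨x, ⟨hx, -⟩, hmax⟩ :=
    ((upperSemicontinuous_uhat hV hw hβh.2 hA2).upperSemicontinuousOn
      (Icc zmin (z0 + 1))).exists_isMaxOn (nonempty_Icc.2 (by linarith)) isCompact_Icc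
  have hneg := hz0' (z0 + 1) (by linarith)
  have hbdd : BddAbove (uhat P V w βh '' Ici (z0 + 1)) := by
    by_contra h
    exact hneg.ne (Real.sSup_of_not_bddAbove h)
  have hle : ∀ y ≥ zmin,
      uhat P V w βh y ≤ max (uhat P V w βh x) (sSup (uhat P V w βh '' Ici (z0 + 1))) := by
    intro y hy
    rcases le_total y (z0 + 1) with h | h
    · exact le_max_of_le_left (hmax ⟨hy, h⟩)
    · exact le_max_of_le_right (le_csSup hbdd (mem_image_of_mem _ h))
  have hx0 : 0 ≤ uhat P V w βh x := by
    by_contra! h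
    refine (max_lt h hneg).not_ge (hz0.symm.trans_le
      (csSup_le (nonempty_Ici.image _) ?_))
    rintro _ ⟨y, hy, rfl⟩
    exact hle y (hzmin.trans hy)
  rw [max_eq_left (hneg.le.trans hx0)] at hle
  have hgreatest : IsGreatest (uhat P V w βh '' Ici zmin) (uhat P V w βh x) := by
    refine ⟨mem_image_of_mem _ hx, ?_⟩
    rintro _ ⟨y, hy, rfl⟩
    exact hle y hy
  exact ⟨x, hx, hgreatest.csSup_eq.symm⟩
end

section
/- Under the exponential type model with λ·w < 1, the subjective expected utility û is strictly decreasing on [-β̂·w, ∞). -/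
open MeasureTheory Real Set Filter ProbabilityTheory
open scoped ENNReal

lemma exponentialPDFReal_eq (r x : ℝ) :
    exponentialPDFReal r x = if 0 ≤ x then r * exp (-(r * x)) else 0 := by
  simp [exponentialPDFReal, gammaPDFReal]

lemma setIntegral_Iic_expMeasure {r : ℝ} (hr : 0 < r) (g : ℝ → ℝ) {a : ℝ} (ha : 0 ≤ a) :
    ∫ x in Iic a, g x ∂expMeasure r = ∫ x in (0 : ℝ)..a, r * exp (-(r * x)) * g x := by
  have h_density : ∫ x in Iic a, g x ∂expMeasure r
      = ∫ x in Iic a, exponentialPDFReal r x * g x := by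
    refine (setIntegral_withDensity_eq_setIntegral_toReal_smul (μ := volume)
      (f := exponentialPDF r) (measurable_exponentialPDFReal r).ennreal_ofReal
      (ae_of_all _ fun _ => ENNReal.ofReal_lt_top) g measurableSet_Iic).trans ?_
    simp only [exponentialPDF, ENNReal.toReal_ofReal (exponentialPDFReal_nonneg hr _),
      smul_eq_mul]
  rw [h_density, setIntegral_eq_of_subset_of_forall_sdiff_eq_zero measurableSet_Iic
    (Icc_subset_Iic_self (a := 0)), intervalIntegral.integral_of_le ha,
    ← integral_Icc_eq_integral_Ioc]
  · refine setIntegral_congr_fun measurableSet_Icc fun x hx => ?_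
    simp [exponentialPDFReal_eq, hx.1]
  · rintro x ⟨hxa, hx⟩
    have hx0 : ¬ 0 ≤ x := fun h => hx ⟨h, hxa⟩
    simp [exponentialPDFReal_eq, hx0]

lemma integral_exp_mul_const_sub {r : ℝ} (hr : r ≠ 0) (w a : ℝ) :
    ∫ x in (0 : ℝ)..a, r * exp (-(r * x)) * (w - x)
      = exp (-(r * a)) * (a - w + r⁻¹) + w - r⁻¹ := by
  have h_deriv : ∀ x ∈ uIcc 0 a, HasDerivAt (fun x => exp (-(r * x)) * (x - w + r⁻¹))
      (r * exp (-(r * x)) * (w - x)) x := by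
    intro x _
    have h := (((hasDerivAt_id x).const_mul r).neg.exp).mul
      (((hasDerivAt_id x).sub_const w).add_const r⁻¹)
    refine h.congr_deriv ?_
    simp only [id, Pi.neg_apply]
    field_simp
    ring
  rw [intervalIntegral.integral_eq_sub_of_hasDerivAt h_deriv
    (Continuous.intervalIntegrable (by fun_prop) _ _)]
  simp
  ring

lemma expMeasure_real_Ioi {r : ℝ} (hr : 0 < r) {a : ℝ} (ha : 0 ≤ a) :
    (expMeasure r).real (Ioi a) = exp (-(r * a)) := by
  have := isProbabilityMeasure_expMeasure hr
  rw [← compl_Iic, probReal_compl_eq_one_sub measurableSet_Iic, ← cdf_eq_real,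
    cdf_expMeasure_eq hr, if_pos ha, sub_sub_cancel]

lemma uhat_exponential_eq {Ω : Type*} [MeasurableSpace Ω] {P : Measure Ω} {V : Ω → ℝ}
    (hV : Measurable V) {r : ℝ} (hr : 0 < r)
    (hVexp : Measure.map (fun ω => -V ω) P = expMeasure r) (w b : ℝ) {z : ℝ}
    (hz : 0 ≤ z + b * w) :
    uhat P V w b z
      = exp (-(r * (z + b * w))) * (r⁻¹ - (1 - b) * w) + (w - r⁻¹) := by
  have h_show : {ω | V ω ≥ -z - b * w} = (fun ω => -V ω) ⁻¹' Iic (z + b * w) := by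
    ext ω
    simp only [mem_ofPred_eq, mem_preimage, mem_Iic]
    constructor <;> intro h <;> linarith
  have h_miss : {ω | V ω < -z - b * w} = (fun ω => -V ω) ⁻¹' Ioi (z + b * w) := by
    ext ω
    simp only [mem_ofPred_eq, mem_preimage, mem_Ioi]
    constructor <;> intro h <;> linarith
  have hV_neg : Measurable fun ω => -V ω := hV.neg
  have h_int := setIntegral_map (μ := P) (g := fun ω => -V ω) (f := fun x => w - x)
    (measurableSet_Iic (a := z + b * w))
    (by fun_prop : Measurable fun x : ℝ => w - x).aestronglyMeasurable hV_neg.aemeasurable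
  simp only [sub_neg_eq_add, add_comm w] at h_int
  rw [uhat, h_show, h_miss, ← h_int, ← Measure.map_apply hV_neg measurableSet_Ioi, hVexp,
    ← measureReal_def, expMeasure_real_Ioi hr hz, setIntegral_Iic_expMeasure hr _ hz,
    integral_exp_mul_const_sub hr.ne']
  ring

/-- Exponential type model with `λ·w < 1`: `û` is strictly decreasing on `[-β̂·w, ∞)`. -/
theorem uhat_exponential_strictAnti {Ω : Type*} [MeasurableSpace Ω] (P : Measure Ω)
    [IsProbabilityMeasure P] (V : Ω → ℝ) (hV : Measurable V)
    (lam : ℝ) (hlam : 0 < lam)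
    (hVexp : Measure.map (fun ω => -V ω) P = expMeasure lam)
    (w : ℝ) (hw : 0 ≤ w) (hlw : lam * w < 1)
    (βh : ℝ) (hβh : βh ∈ Set.Icc (0 : ℝ) 1) :
    StrictAntiOn (uhat P V w βh) (Set.Ici (-βh * w)) := by
  intro z₁ h₁ z₂ h₂ h_lt
  rw [mem_Ici] at h₁ h₂
  rw [uhat_exponential_eq hV hlam hVexp w βh (by linarith),
    uhat_exponential_eq hV hlam hVexp w βh (by linarith)]
  have h_inv : w < lam⁻¹ := by
    rwa [← one_div, lt_div_iff₀ hlam, mul_comm]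
  have h_coeff : 0 < lam⁻¹ - (1 - βh) * w := by
    linarith [mul_nonneg hβh.1 hw]
  gcongr
end
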